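/- arXiv:1405.3132 — 2 statements merged into one kernel-verified Lean document; each statement's English description precedes it below -/
import Mathlib

section
/- Let k ≥ 2 be a power of two, G an abelian group, A and B finite nonempty subsets of G, and P ⊆ A − B. Define ν(x) := |{(a,b) ∈ A × B : a − b = x}|. Then (Σ_{x∈P} ν(x))^{4k} ≤ (|A|·|B|)^{2k} · (Σ_{x∈G} |A ∩ (A − x)|^k · |B ∩ (B − x)|^k) · T_k(P). -/
open Finset Pointwise

variable {G : Type*} [AddCommGroup G] [DecidableEq G]

/-- `A_s = A ∩ (A - s) = {x ∈ A : x + s ∈ A}`. -/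
def stab (A : Finset G) (s : G) : Finset G := A ∩ A.image (fun a => a - s)

/-- `ν(x) = |{(a,b) ∈ A × B : a - b = x}| = |A ∩ (B + x)|`. -/
def nuAB (A B : Finset G) (x : G) : ℕ := (A ∩ B.image (fun b => b + x)).card

/-- `T_k(P)`: the number of `2k`-tuples of elements of `P` with
`p₁ + ⋯ + p_k = p₁' + ⋯ + p_k'`. -/
def Tk (k : ℕ) (P : Finset G) : ℕ :=
  (((Fintype.piFinset fun _ : Fin k => P) ×ˢ (Fintype.piFinset fun _ : Fin k => P)).filter
    (fun p => ∑ i, p.1 i = ∑ i, p.2 i)).card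

/-- Sums over walks in terms of matrix powers. -/
lemma walk_sum {ι : Type*} [Fintype ι] [DecidableEq ι] (N : Matrix ι ι ℕ) (n : ℕ) :
    ∀ g : ι → ι → ℕ,
    ∑ f : Fin (n + 1) → ι, (∏ t : Fin n, N (f t.castSucc) (f t.succ)) * g (f 0) (f (Fin.last n))
      = ∑ i, ∑ j, (N ^ n) i j * g i j := by
  induction n with
  | zero =>
    intro g
    rw [← (Equiv.funUnique (Fin 1) ι).symm.sum_comp]
    simp [Matrix.one_apply]
  | succ n ih =>
    intro g
    rw [← (Fin.consEquiv (fun _ : Fin (n + 2) => ι)).sum_comp, Fintype.sum_prod_type,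
      Finset.sum_comm]
    have h1 := ih (fun x y => ∑ i, N i x * g i y)
    have h2 : ∀ f : Fin (n + 1) → ι,
        (∑ i, (∏ t : Fin (n + 1), N ((Fin.consEquiv (fun _ : Fin (n + 2) => ι)) (i, f) t.castSucc)
          ((Fin.consEquiv (fun _ : Fin (n + 2) => ι)) (i, f) t.succ)) *
          g ((Fin.consEquiv (fun _ : Fin (n + 2) => ι)) (i, f) 0)
            ((Fin.consEquiv (fun _ : Fin (n + 2) => ι)) (i, f) (Fin.last (n + 1))))
        = (∏ t : Fin n, N (f t.castSucc) (f t.succ)) * ∑ i, N i (f 0) * g i (f (Fin.last n)) := by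
      intro f
      rw [Finset.mul_sum]
      refine Finset.sum_congr rfl fun i _ => ?_
      rw [Fin.prod_univ_succ]
      simp only [Fin.consEquiv_apply, ← Fin.succ_last, Fin.cons_succ, Fin.castSucc_zero,
        Fin.cons_zero, ← Fin.succ_castSucc]
      ring
    rw [Finset.sum_congr rfl fun f _ => h2 f, h1]
    simp only [pow_succ', Matrix.mul_apply, Finset.sum_mul, Finset.mul_sum]
    rw [Finset.sum_congr rfl fun x _ => Finset.sum_comm, Finset.sum_comm]
    refine Finset.sum_congr rfl fun i _ => ?_
    rw [Finset.sum_comm]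
    refine Finset.sum_congr rfl fun j _ => Finset.sum_congr rfl fun x _ => ?_
    ring

lemma trace_sum {ι : Type*} [Fintype ι] [DecidableEq ι] (N : Matrix ι ι ℕ) (n : ℕ) :
    ∑ f : Fin (n + 1) → ι, ∏ t : Fin (n + 1), N (f t) (f (t + 1)) = (N ^ (n + 1)).trace := by
  have h := walk_sum N n (fun x y => N y x)
  simp only [Fin.prod_univ_castSucc, Fin.coeSucc_eq_succ, Fin.last_add_one]
  rw [h]
  simp only [pow_succ, Matrix.trace, Matrix.diag, Matrix.mul_apply]

lemma pow_sum_bound {ι : Type*} [Fintype ι] [DecidableEq ι] (N : Matrix ι ι ℕ)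
    (hN : N.transpose = N) (m : ℕ) :
    (∑ i, ∑ j, N i j) ^ (2 ^ m) * Fintype.card ι ≤
      Fintype.card ι ^ (2 ^ m) * ∑ i, ∑ j, (N ^ (2 ^ m)) i j := by
  induction m with
  | zero => simp [mul_comm]
  | succ m ih =>
    set Q := N ^ (2 ^ m) with hQ
    have hQs : Q.transpose = Q := by rw [hQ, Matrix.transpose_pow, hN]
    have hQs' : ∀ i j, Q i j = Q j i := fun i j => by
      conv_lhs => rw [← hQs]
      rfl
    have h1 : N ^ (2 ^ (m + 1)) = Q * Q := by rw [hQ, ← pow_add]; congr 1; ring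
    have h2 : ∑ i, ∑ j, (Q * Q) i j = ∑ x, (∑ i, Q x i) ^ 2 := by
      simp only [Matrix.mul_apply]
      rw [Finset.sum_congr rfl fun x _ => Finset.sum_comm, Finset.sum_comm]
      refine Finset.sum_congr rfl fun x _ => ?_
      rw [sq, Finset.sum_mul_sum]
      refine Finset.sum_congr rfl fun i _ => Finset.sum_congr rfl fun j _ => ?_
      rw [hQs' i x]
    have h3 : (∑ x, ∑ i, Q x i) ^ 2 ≤ Fintype.card ι * ∑ x, (∑ i, Q x i) ^ 2 := by
      simpa using sq_sum_le_card_mul_sum_sq (s := (Finset.univ : Finset ι)) (f := fun x => ∑ i, Q x i)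
    rw [h1, h2]
    set S := ∑ i, ∑ j, N i j
    set c := Fintype.card ι
    rcases Nat.eq_zero_or_pos c with hc | hc
    · rw [hc]; simp
    have h4 : (S ^ 2 ^ m * c) ^ 2 ≤ (c ^ 2 ^ m) ^ 2 * (c * ∑ x, (∑ i, Q x i) ^ 2) := by
      calc _ ≤ (c ^ 2 ^ m * ∑ i, ∑ j, Q i j) ^ 2 := Nat.pow_le_pow_left ih 2
        _ = (c ^ 2 ^ m) ^ 2 * (∑ i, ∑ j, Q i j) ^ 2 := by ring
        _ ≤ _ := Nat.mul_le_mul_left _ h3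
    refine Nat.le_of_mul_le_mul_right ?_ hc
    calc _ = (S ^ 2 ^ m * c) ^ 2 := by ring
      _ ≤ _ := h4
      _ = _ := by ring

lemma trace_bound {ι : Type*} [Fintype ι] [DecidableEq ι] (N : Matrix ι ι ℕ)
    (hN : N.transpose = N) (m : ℕ) :
    (∑ i, ∑ j, N i j) ^ (2 ^ (m + 1)) ≤
      Fintype.card ι ^ (2 ^ (m + 1)) * (N ^ (2 ^ (m + 1))).trace := by
  have hb := pow_sum_bound N hN m
  set Q := N ^ (2 ^ m) with hQ
  have hQs : Q.transpose = Q := by rw [hQ, Matrix.transpose_pow, hN]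
  have hQs' : ∀ i j, Q i j = Q j i := fun i j => by
    conv_lhs => rw [← hQs]
    rfl
  have h1 : N ^ (2 ^ (m + 1)) = Q * Q := by rw [hQ, ← pow_add]; congr 1; ring
  have h2 : (Q * Q).trace = ∑ x : ι × ι, (Q x.1 x.2) ^ 2 := by
    rw [Fintype.sum_prod_type]
    simp only [Matrix.trace, Matrix.diag, Matrix.mul_apply]
    refine Finset.sum_congr rfl fun i _ => Finset.sum_congr rfl fun j _ => ?_
    rw [hQs' j i, sq]
  have h3 : (∑ i, ∑ j, Q i j) ^ 2 ≤ Fintype.card ι ^ 2 * ∑ x : ι × ι, (Q x.1 x.2) ^ 2 := by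
    have := sq_sum_le_card_mul_sum_sq (s := (Finset.univ : Finset (ι × ι)))
      (f := fun x => Q x.1 x.2)
    rw [Fintype.sum_prod_type] at this
    simpa [sq] using this
  rw [h1, h2]
  set S := ∑ i, ∑ j, N i j with hS
  set c := Fintype.card ι with hc'
  rcases Nat.eq_zero_or_pos c with hc | hc
  · have : IsEmpty ι := Fintype.card_eq_zero_iff.mp hc
    simp [hS]
  have h4 : (S ^ 2 ^ m * c) ^ 2 ≤ (c ^ 2 ^ m) ^ 2 * (c ^ 2 * ∑ x : ι × ι, (Q x.1 x.2) ^ 2) := by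
    calc _ ≤ (c ^ 2 ^ m * ∑ i, ∑ j, Q i j) ^ 2 := Nat.pow_le_pow_left hb 2
      _ = (c ^ 2 ^ m) ^ 2 * (∑ i, ∑ j, Q i j) ^ 2 := by ring
      _ ≤ _ := Nat.mul_le_mul_left _ h3
  refine Nat.le_of_mul_le_mul_right ?_ (pow_pos hc 2)
  calc _ = (S ^ 2 ^ m * c) ^ 2 := by ring
    _ ≤ _ := h4
    _ = _ := by ring

/-- common neighbours matrix -/
def nbr (A B P : Finset G) : Matrix A A ℕ :=
  fun a a' => (B.filter fun b => (a : G) - b ∈ P ∧ (a' : G) - b ∈ P).card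

/-- closed walks -/
def cyc (n : ℕ) (A B P : Finset G) : Finset ((_ : Fin (n + 1) → A) × (Fin (n + 1) → G)) :=
  (Finset.univ : Finset (Fin (n + 1) → A)).sigma fun a =>
    Fintype.piFinset fun i => B.filter fun b => (a i : G) - b ∈ P ∧ (a (i + 1) : G) - b ∈ P

lemma card_cyc (n : ℕ) (A B P : Finset G) :
    (cyc n A B P).card = (nbr A B P ^ (n + 1)).trace := by
  rw [← trace_sum, cyc, Finset.card_sigma]
  simp only [Fintype.card_piFinset, nbr]

lemma nbr_sum (A B P : Finset G) :
    (∑ x ∈ P, nuAB A B x) ^ 2 ≤ B.card * ∑ i, ∑ j, nbr A B P i j := by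
  have h1 : ∑ x ∈ P, nuAB A B x = ∑ b ∈ B, ∑ a : A, if (a : G) - b ∈ P then 1 else 0 := by
    have : ∀ x, nuAB A B x = ∑ b ∈ B, ∑ a ∈ A, if a - b = x then 1 else 0 := by
      intro x
      have : A ∩ B.image (fun b => b + x) = (B.filter fun b => b + x ∈ A).image (fun b => b + x) := by
        ext y
        simp only [mem_inter, mem_image, mem_filter]
        constructor
        · rintro ⟨h, b, hb, rfl⟩
          exact ⟨b, ⟨hb, h⟩, rfl⟩
        · rintro ⟨b, ⟨hb, h⟩, rfl⟩
          exact ⟨h, b, hb, rfl⟩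
      rw [nuAB, this, Finset.card_image_of_injective _ (add_left_injective x), Finset.card_filter]
      refine Finset.sum_congr rfl fun b _ => ?_
      simp only [sub_eq_iff_eq_add, add_comm x b]
      simp
    simp only [this]
    rw [Finset.sum_comm]
    refine Finset.sum_congr rfl fun b _ => ?_
    rw [Finset.sum_comm, ← Finset.sum_coe_sort A]
    refine Finset.sum_congr rfl fun a _ => ?_
    simp
  have h2 : ∑ i, ∑ j, nbr A B P i j
      = ∑ b ∈ B, (∑ a : A, if (a : G) - b ∈ P then 1 else 0) ^ 2 := by
    simp only [nbr, Finset.card_filter]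
    rw [Finset.sum_congr rfl fun x _ => Finset.sum_comm, Finset.sum_comm]
    refine Finset.sum_congr rfl fun b _ => ?_
    rw [sq, Finset.sum_mul_sum]
    refine Finset.sum_congr rfl fun i _ => Finset.sum_congr rfl fun j _ => ?_
    by_cases h : (i : G) - b ∈ P <;> simp [h]
  rw [h1, h2]
  exact sq_sum_le_card_mul_sum_sq

/-- differences along a walk -/
def dmap (n : ℕ) (A : Finset G) (w : (_ : Fin (n + 1) → A) × (Fin (n + 1) → G)) :
    (Fin (n + 1) → G) × (Fin (n + 1) → G) :=
  (fun i => (w.1 i : G) - w.2 i, fun i => (w.1 (i + 1) : G) - w.2 i)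

/-- the index set of `T_k`. -/
def tset (k : ℕ) (P : Finset G) : Finset ((Fin k → G) × (Fin k → G)) :=
  ((Fintype.piFinset fun _ : Fin k => P) ×ˢ (Fintype.piFinset fun _ : Fin k => P)).filter
    (fun p => ∑ i, p.1 i = ∑ i, p.2 i)

lemma dmap_mem (n : ℕ) (A B P : Finset G) (w) (hw : w ∈ cyc n A B P) :
    dmap n A w ∈ tset (n + 1) P := by
  simp only [cyc, mem_sigma, Fintype.mem_piFinset, mem_filter, mem_univ, true_and] at hw
  simp only [tset, dmap, mem_filter, mem_product, Fintype.mem_piFinset]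
  refine ⟨⟨fun i => (hw i).2.1, fun i => (hw i).2.2⟩, ?_⟩
  rw [Finset.sum_sub_distrib, Finset.sum_sub_distrib]
  congr 1
  exact (Equiv.sum_comp (Equiv.addRight (1 : Fin (n + 1))) (fun i => (w.1 i : G))).symm

lemma const_of_step {n : ℕ} (f : Fin (n + 1) → G) (h : ∀ i, f (i + 1) = f i) (i) : f i = f 0 := by
  induction i using Fin.induction with
  | zero => rfl
  | succ i ih => rw [← Fin.coeSucc_eq_succ, h, ih]

lemma pairs_bound (n : ℕ) (A B P : Finset G) :
    ((cyc n A B P ×ˢ cyc n A B P).filter fun w => dmap n A w.1 = dmap n A w.2).card ≤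
      ∑ x ∈ A - A, (stab A x).card ^ (n + 1) * (stab B x).card ^ (n + 1) := by
  have : ∑ x ∈ A - A, (stab A x).card ^ (n + 1) * (stab B x).card ^ (n + 1) =
      ((A - A).sigma fun x => (Fintype.piFinset fun _ : Fin (n + 1) => stab A x) ×ˢ
        (Fintype.piFinset fun _ : Fin (n + 1) => stab B x)).card := by
    simp [Finset.card_sigma, Finset.card_product, Fintype.card_piFinset]
  rw [this]
  have key : ∀ w ∈ ((cyc n A B P ×ˢ cyc n A B P).filter fun w => dmap n A w.1 = dmap n A w.2),
      (∀ i, w.1.2 i ∈ B ∧ w.2.2 i ∈ B) ∧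
      (∀ i, (w.2.1 i : G) = w.1.1 i + ((w.2.1 0 : G) - w.1.1 0)) ∧
      (∀ i, w.2.2 i = w.1.2 i + ((w.2.1 0 : G) - w.1.1 0)) := by
    rintro ⟨⟨a, b⟩, ⟨a', b'⟩⟩ hw
    simp only [cyc, mem_sigma, Fintype.mem_piFinset, mem_filter, mem_univ, true_and,
      mem_product, dmap, Prod.mk.injEq] at hw
    obtain ⟨⟨h1, h2⟩, h3, h4⟩ := hw
    have h3' := fun i => congrFun h3 i
    have h4' := fun i => congrFun h4 i
    have hc := const_of_step (fun i => (a' i : G) - a i) (by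
      intro i
      have e1 := h3' i
      have e2 := h4' i
      rw [sub_eq_sub_iff_add_eq_add] at e1 e2
      rw [sub_eq_sub_iff_add_eq_add]
      have : ((a' (i+1) : G) + a i) + (b i + b' i) = (a' i + a (i+1)) + (b i + b' i) := by
        calc _ = ((a' (i+1) : G) + b i) + (a i + b' i) := by abel
          _ = ((a (i+1) : G) + b' i) + (a' i + b i) := by rw [e1, e2]
          _ = _ := by abel
      exact add_right_cancel this)
    refine ⟨fun i => ⟨(h1 i).1, (h2 i).1⟩, fun i => ?_, fun i => ?_⟩
    · simp only
      rw [← hc i]; abel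
    · simp only
      rw [← hc i]
      have e1 := h3' i
      rw [sub_eq_sub_iff_add_eq_add] at e1
      have : b' i = (a i + b' i) - a i := by abel
      rw [this, e1]; abel
  have memstab : ∀ (C : Finset G) (x y : G), x ∈ C → x + y ∈ C → x ∈ stab C y := by
    intro C x y h1 h2
    simp only [stab, mem_inter, mem_image]
    exact ⟨h1, x + y, h2, by abel⟩
  refine Finset.card_le_card_of_injOn
    (fun w => ⟨(w.2.1 0 : G) - w.1.1 0, (fun i => (w.1.1 i : G), w.1.2)⟩) ?_ ?_
  · intro w hw
    obtain ⟨k1, k2, k3⟩ := key w hw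
    simp only [coe_sigma, Set.mem_sigma_iff, mem_coe, mem_product, Fintype.mem_piFinset]
    refine ⟨Finset.sub_mem_sub (w.2.1 0).2 (w.1.1 0).2, fun i => memstab _ _ _ (w.1.1 i).2 ?_,
      fun i => memstab _ _ _ (k1 i).1 ?_⟩
    · rw [← k2 i]; exact (w.2.1 i).2
    · rw [← k3 i]; exact (k1 i).2
  · intro w hw v hv h
    obtain ⟨-, k2, k3⟩ := key w hw
    obtain ⟨-, l2, l3⟩ := key v hv
    obtain ⟨⟨a, b⟩, ⟨a', b'⟩⟩ := w
    obtain ⟨⟨c, d⟩, ⟨c', d'⟩⟩ := v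
    simp only [Sigma.mk.injEq, heq_eq_eq, Prod.mk.injEq] at h k2 k3 l2 l3
    obtain ⟨h0, h1, h2⟩ := h
    have h1' := fun i => congrFun h1 i
    have e1 : a = c := funext fun i => Subtype.ext (h1' i)
    have e2 : a' = c' := funext fun i => Subtype.ext (by rw [k2 i, l2 i, h0, h1' i])
    have e3 : b' = d' := funext fun i => by rw [k3 i, l3 i, h0, h2]
    subst e1 e2 e3 h2
    rfl

lemma cyc_sq (n : ℕ) (A B P : Finset G) :
    (cyc n A B P).card ^ 2 ≤
      (∑ x ∈ A - A, (stab A x).card ^ (n + 1) * (stab B x).card ^ (n + 1)) * Tk (n + 1) P := by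
  have hT : Tk (n + 1) P = (tset (n + 1) P).card := rfl
  have h1 := Finset.card_eq_sum_card_fiberwise (f := dmap n A) (s := cyc n A B P)
    (t := tset (n + 1) P) (fun w hw => dmap_mem n A B P w hw)
  have h2 : ∑ y ∈ tset (n + 1) P, ((cyc n A B P).filter fun w => dmap n A w = y).card ^ 2 ≤
      ((cyc n A B P ×ˢ cyc n A B P).filter fun w => dmap n A w.1 = dmap n A w.2).card := by
    rw [Finset.card_eq_sum_card_fiberwise (f := fun w => dmap n A w.1)
      (t := tset (n + 1) P)]
    · refine Finset.sum_le_sum fun y _ => ?_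
      rw [sq, ← Finset.card_product]
      refine Finset.card_le_card fun w hw => ?_
      simp only [mem_product, mem_filter] at hw ⊢
      exact ⟨⟨⟨hw.1.1, hw.2.1⟩, hw.1.2.trans hw.2.2.symm⟩, hw.1.2⟩
    · intro w hw
      simp only [coe_filter, mem_product, Set.mem_setOf_eq] at hw
      exact dmap_mem n A B P w.1 hw.1.1
  rw [hT, mul_comm]
  conv_lhs => rw [h1]
  exact sq_sum_le_card_mul_sum_sq.trans (Nat.mul_le_mul_left _ (h2.trans (pairs_bound n A B P)))

theorem stmt_11 (k : ℕ) (hk : 2 ≤ k) (hpow : ∃ m : ℕ, k = 2 ^ m)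
    (A B : Finset G) (hA : A.Nonempty) (hB : B.Nonempty)
    (P : Finset G) (hP : P ⊆ A - B) :
    (∑ x ∈ P, nuAB A B x) ^ (4 * k) ≤
      (A.card * B.card) ^ (2 * k) *
        (∑ x ∈ A - A, (stab A x).card ^ k * (stab B x).card ^ k) * Tk k P := by
  obtain ⟨m, hm⟩ := hpow
  obtain ⟨m, rfl⟩ : ∃ j, m = j + 1 := by
    refine Nat.exists_eq_succ_of_ne_zero ?_
    rintro rfl
    simp at hm
    omega
  have hN : (nbr A B P).transpose = nbr A B P := by
    ext i j
    simp only [Matrix.transpose_apply, nbr]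
    congr 1
    ext b
    simp [and_comm]
  have h1 := trace_bound (nbr A B P) hN m
  have h2 := nbr_sum A B P
  rw [← hm, Fintype.card_coe] at h1
  obtain ⟨n, rfl⟩ : ∃ n, k = n + 1 := ⟨k - 1, by omega⟩
  rw [← card_cyc] at h1
  have h3 := cyc_sq n A B P
  generalize (∑ x ∈ A - A, (stab A x).card ^ (n + 1) * (stab B x).card ^ (n + 1)) = R at *
  generalize (∑ x ∈ P, nuAB A B x) = s at *
  generalize (∑ i, ∑ j, nbr A B P i j) = t at *
  calc s ^ (4 * (n + 1)) = ((s ^ 2) ^ (n + 1)) ^ 2 := by rw [← pow_mul, ← pow_mul]; congr 1; ring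
    _ ≤ ((B.card * t) ^ (n + 1)) ^ 2 := by gcongr
    _ = (B.card ^ (n + 1) * t ^ (n + 1)) ^ 2 := by rw [mul_pow]
    _ ≤ (B.card ^ (n + 1) * (A.card ^ (n + 1) * (cyc n A B P).card)) ^ 2 := by gcongr
    _ = (A.card * B.card) ^ (2 * (n + 1)) * (cyc n A B P).card ^ 2 := by ring
    _ ≤ (A.card * B.card) ^ (2 * (n + 1)) * (R * Tk (n + 1) P) := by gcongr
    _ = _ := by ring
end

section
/- Let G be an abelian group, A a finite nonempty subset of G, and k ≥ 2 an integer. Then ‖A‖_{𝕌^{k+1}}^{k−1} · ‖A‖_{𝕌^{k−1}}^{2k} ≥ ‖A‖_{𝕌^{k}}^{3k−2}. In particular (k = 2), ‖A‖_{𝕌³} · |A|⁸ ≥ E(A)⁴. -/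
open Finset Pointwise

variable {G : Type*} [AddCommGroup G] [DecidableEq G]

/-- The local Gowers quantity `‖A‖_{𝕌^d}`: the number of tuples
`(x, h₁, …, h_d)` such that `x + ∑_{i ∈ S} h_i ∈ A` for every `S ⊆ {1,…,d}`.
(Any such tuple automatically has `x ∈ A` and `h_i ∈ A - A`.) -/
def gowersU (A : Finset G) (d : ℕ) : ℕ :=
  ((A ×ˢ Fintype.piFinset fun _ : Fin d => (A - A)).filter
    (fun p => ∀ S : Finset (Fin d), p.1 + ∑ i ∈ S, p.2 i ∈ A)).card

/-- The additive energy `E(A) = ‖A‖_{𝕌²}`. -/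
def energy (A : Finset G) : ℕ := gowersU A 2

/-- Jensen inequality for the logarithm, in unnormalised form. -/
theorem jensen_aux {ι : Type*} [Fintype ι] (w x : ι → ℝ) (hw : ∀ i, 0 ≤ w i)
    (hx : ∀ i, 0 < w i → 0 < x i) (X W : ℝ) (hX : 0 < X) (hW : 0 < W) (hWs : ∑ i, w i = W)
    (hs : ∑ i, w i * x i ≤ X) :
    ∑ i, w i * Real.log (x i) ≤ W * (Real.log X - Real.log W) := by
  have h1 : ∀ i, w i * Real.log (x i) ≤
      w i * (Real.log X - Real.log W - 1) + (w i * x i) * (W / X) := by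
    intro i
    rcases (hw i).eq_or_lt with h | h
    · simp [← h]
    · have hxi := hx i h
      have := Real.log_le_sub_one_of_pos (show 0 < x i * (W / X) by positivity)
      rw [Real.log_mul hxi.ne' (by positivity), Real.log_div hW.ne' hX.ne'] at this
      have := mul_le_mul_of_nonneg_left this (hw i)
      linarith
  calc _ ≤ ∑ i, (w i * (Real.log X - Real.log W - 1) + (w i * x i) * (W / X)) :=
        Finset.sum_le_sum fun i _ => h1 i
    _ = W * (Real.log X - Real.log W - 1) + (∑ i, w i * x i) * (W / X) := by
        rw [Finset.sum_add_distrib, ← Finset.sum_mul, ← Finset.sum_mul, hWs]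
    _ ≤ W * (Real.log X - Real.log W - 1) + X * (W / X) := by gcongr
    _ = _ := by field_simp; ring

/-- Discrete Loomis-Whitney (grid lines) inequality. -/
theorem lw_aux {T : Type*} [Fintype T] (n : ℕ) (a : (Fin (n + 2) → T) → ℝ)
    (ha : ∀ h, 0 ≤ a h) :
    ∑ h, ∏ i, (∑ t, a (Function.update h i t)) ^ ((1 : ℝ) / (n + 1)) ≤
      (∑ h, a h) ^ (((n : ℝ) + 2) / (n + 1)) := by
  classical
  let : MeasurableSpace T := ⊤
  have : MeasurableSingletonClass T := ⟨fun _ => trivial⟩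
  have hp : Real.HolderConjugate (Fintype.card (Fin (n + 2))) (((n : ℝ) + 2) / (n + 1)) := by
    rw [Real.holderConjugate_iff]
    constructor
    · simp; linarith
    · simp; field_simp; ring
  have key := MeasureTheory.lintegral_prod_lintegral_pow_le
    (μ := fun _ : Fin (n + 2) => (MeasureTheory.Measure.count : MeasureTheory.Measure T))
    hp (f := fun h => ENNReal.ofReal (a h)) (measurable_of_countable _)
  simp only [MeasureTheory.lintegral_fintype, MeasureTheory.Measure.pi_singleton,
    MeasureTheory.Measure.count_singleton, Finset.prod_const_one, mul_one] at key
  have hc : ((Fintype.card (Fin (n + 2)) : ℝ) - 1) = n + 1 := by simp; ring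
  rw [hc] at key
  have e1 : ∀ h : Fin (n + 2) → T,
      ∏ i, (∑ t, ENNReal.ofReal (a (Function.update h i t))) ^ ((1 : ℝ) / (n + 1)) =
      ENNReal.ofReal (∏ i, (∑ t, a (Function.update h i t)) ^ ((1 : ℝ) / (n + 1))) := by
    intro h
    rw [ENNReal.ofReal_prod_of_nonneg
      (fun i _ => Real.rpow_nonneg (Finset.sum_nonneg fun t _ => ha _) _)]
    refine Finset.prod_congr rfl fun i _ => ?_
    rw [← ENNReal.ofReal_sum_of_nonneg (fun t _ => ha _),
      ENNReal.ofReal_rpow_of_nonneg (Finset.sum_nonneg fun t _ => ha _) (by positivity)]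
  have hn : ∀ h : Fin (n + 2) → T,
      0 ≤ ∏ i, (∑ t, a (Function.update h i t)) ^ ((1 : ℝ) / (n + 1)) := fun h =>
    Finset.prod_nonneg fun i _ => Real.rpow_nonneg (Finset.sum_nonneg fun t _ => ha _) _
  rw [Finset.sum_congr rfl (fun h _ => e1 h), ← ENNReal.ofReal_sum_of_nonneg (fun h _ => hn h),
    ← ENNReal.ofReal_sum_of_nonneg (fun h _ => ha h),
    ENNReal.ofReal_rpow_of_nonneg (Finset.sum_nonneg fun t _ => ha _) (by positivity)] at key
  exact (ENNReal.ofReal_le_ofReal_iff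
    (Real.rpow_nonneg (Finset.sum_nonneg fun t _ => ha _) _)).1 key

theorem sum_insertNth_aux {T : Type*} [Fintype T] (n : ℕ) (i : Fin (n + 1))
    {M : Type*} [AddCommMonoid M] (F : (Fin (n + 1) → T) → M) :
    ∑ h, F h = ∑ h' : Fin n → T, ∑ t : T, F (i.insertNth (α := fun _ => T) t h') := by
  rw [← (Fin.insertNthEquiv (fun _ => T) i).sum_comp, Fintype.sum_prod_type, Finset.sum_comm]
  rfl

theorem core_aux {T : Type*} [Fintype T] (n : ℕ) (a : (Fin (n + 2) → T) → ℝ)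
    (c : (Fin (n + 1) → T) → ℝ) (ha : ∀ h, 0 ≤ a h) (hc : ∀ h, 0 ≤ c h)
    (hac : ∀ (i : Fin (n + 2)) (h' : Fin (n + 1) → T), ∑ t, a (i.insertNth (α := fun _ => T) t h') = c h' ^ 2)
    (N M U : ℝ) (hN : 0 < N) (hM : 0 < M) (hU : 0 < U)
    (hNs : ∑ h, a h = N) (hMs : ∑ h, c h = M) (hUs : ∑ h, a h ^ 2 = U) :
    (3 * n + 4) * Real.log N ≤ (n + 1) * Real.log U + (2 * (n + 2)) * Real.log M := by
  classical
  have hn1 : (0 : ℝ) < n + 1 := by positivity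
  have hNs' : ∑ h, c h ^ 2 = N := by
    rw [← hNs, sum_insertNth_aux (n + 1) 0]
    exact Finset.sum_congr rfl fun h _ => (hac 0 h).symm
  -- step 1
  have s1 : ∑ h, a h * Real.log (a h) ≤ N * (Real.log U - Real.log N) :=
    jensen_aux a a ha (fun _ h => h) U N hU hN hNs (by rw [← hUs]; simp [sq])
  -- step 3
  have s3 : ∑ h, c h ^ 2 * Real.log (c h)⁻¹ ≤ N * (Real.log M - Real.log N) := by
    refine jensen_aux (fun h => c h ^ 2) (fun h => (c h)⁻¹) (fun h => sq_nonneg _) ?_ M N hM hN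
      hNs' ?_
    · intro h hh
      have : c h ≠ 0 := by rintro h0; simp [h0] at hh
      exact inv_pos.2 (lt_of_le_of_ne (hc h) this.symm)
    · rw [← hMs]
      refine Finset.sum_le_sum fun h _ => le_of_eq ?_
      by_cases h0 : c h = 0
      · simp [h0]
      · field_simp
  -- marginals
  have hb : ∀ (h : Fin (n + 2) → T) i,
      ∑ t, a (Function.update h i t) = c (i.removeNth h) ^ 2 := by
    intro h i
    rw [← hac i]
    refine Finset.sum_congr rfl fun t _ => ?_
    rw [Fin.insertNth_removeNth]
  have hpos : ∀ (h : Fin (n + 2) → T) (i : Fin (n + 2)), 0 < a h → 0 < c (i.removeNth h) := by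
    intro h i hh
    have : 0 < c (i.removeNth h) ^ 2 := by
      rw [← hb]
      refine lt_of_lt_of_le hh ?_
      have := Finset.single_le_sum (f := fun t => a (Function.update h i t))
        (fun t _ => ha _) (Finset.mem_univ (h i))
      simpa using this
    exact lt_of_le_of_ne (hc _) (by rintro h0; simp [← h0] at this)
  have s4 : ∀ i : Fin (n + 2), ∑ h, a h * Real.log (c (i.removeNth h)) =
      ∑ h', c h' ^ 2 * Real.log (c h') := by
    intro i
    rw [sum_insertNth_aux (n + 1) i]
    refine Finset.sum_congr rfl fun h' _ => ?_
    simp only [Fin.removeNth_insertNth]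
    rw [← Finset.sum_mul, hac]
  -- step 2
  have lw := lw_aux n a ha
  rw [hNs] at lw
  have hQ : ∀ h : Fin (n + 2) → T, 0 ≤ ∏ i : Fin (n + 2), (c (i.removeNth h) ^ 2) ^ ((1 : ℝ) / (n + 1)) := fun h =>
    Finset.prod_nonneg fun i _ => Real.rpow_nonneg (sq_nonneg _) _
  have s2 := jensen_aux a
    (fun h : Fin (n + 2) → T => (∏ i : Fin (n + 2), (c (i.removeNth h) ^ 2) ^ ((1 : ℝ) / (n + 1))) / a h) ha
    (fun h hh => div_pos (Finset.prod_pos fun i _ =>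
      Real.rpow_pos_of_pos (pow_pos (hpos h i hh) 2) _) hh)
    (N ^ (((n : ℝ) + 2) / (n + 1))) N (Real.rpow_pos_of_pos hN _) hN hNs (by
      refine le_trans (Finset.sum_le_sum fun h _ => ?_) lw
      simp only [hb]
      by_cases h0 : a h = 0
      · simpa [h0] using hQ h
      · rw [mul_div_cancel₀ _ h0])
  have e2 : ∀ h : Fin (n + 2) → T, a h * Real.log
      ((∏ i : Fin (n + 2), (c (i.removeNth h) ^ 2) ^ ((1 : ℝ) / (n + 1))) / a h) =
      (2 / (n + 1)) * (∑ i : Fin (n + 2), a h * Real.log (c (i.removeNth h)))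
        - a h * Real.log (a h) := by
    intro h
    rcases (ha h).eq_or_lt with h0 | h0
    · simp [← h0]
    · rw [Real.log_div (Finset.prod_pos fun i _ =>
        Real.rpow_pos_of_pos (pow_pos (hpos h i h0) 2) _).ne' h0.ne',
        Real.log_prod (fun i _ => (Real.rpow_pos_of_pos (pow_pos (hpos h i h0) 2) _).ne')]
      rw [← Finset.mul_sum]
      have : ∀ i : Fin (n + 2), Real.log ((c (i.removeNth h) ^ 2) ^ ((1 : ℝ) / (n + 1))) =
          (2 / (n + 1)) * Real.log (c (i.removeNth h)) := by
        intro i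
        rw [Real.log_rpow (pow_pos (hpos h i h0) 2), Real.log_pow]
        push_cast; ring
      simp only [this]
      rw [← Finset.mul_sum]
      ring
  rw [Finset.sum_congr rfl (fun h _ => e2 h), Finset.sum_sub_distrib, ← Finset.mul_sum,
    Finset.sum_comm, Finset.sum_congr rfl (fun i _ => s4 i), Real.log_rpow hN] at s2
  simp only [Finset.sum_const, Finset.card_univ, Fintype.card_fin, nsmul_eq_mul] at s2
  simp only [Real.log_inv, mul_neg, Finset.sum_neg_distrib] at s3
  push_cast at s2
  set P := ∑ h', c h' ^ 2 * Real.log (c h')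
  set R := ∑ h, a h * Real.log (a h)
  have s2' : 2 * (n + 2) * P - (n + 1) * R ≤ N * Real.log N := by
    have := mul_le_mul_of_nonneg_left s2 hn1.le
    have e3 : ((n : ℝ) + 1) * (2 / (n + 1) * ((n + 2) * P) - R) =
      2 * (n + 2) * P - (n + 1) * R := by field_simp
    have e4 : ((n : ℝ) + 1) * (N * ((n + 2) / (n + 1) * Real.log N - Real.log N)) =
      N * Real.log N := by field_simp; ring
    rw [e3, e4] at this
    exact this
  have s1' := mul_le_mul_of_nonneg_left s1 hn1.le
  have s3' := mul_le_mul_of_nonneg_left s3 (show (0 : ℝ) ≤ 2 * (n + 2) by positivity)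
  refine le_of_mul_le_mul_left (a := N) ?_ hN
  linarith

/-- base points of the cubes in `A` with given sides -/
def cubeBase (A : Finset G) {d : ℕ} (h : Fin d → G) : Finset G :=
  A.filter fun x => ∀ S : Finset (Fin d), x + ∑ i ∈ S, h i ∈ A

theorem mem_cubeBase (A : Finset G) {d : ℕ} (h : Fin d → G) (x : G) :
    x ∈ cubeBase A h ↔ ∀ S : Finset (Fin d), x + ∑ i ∈ S, h i ∈ A := by
  unfold cubeBase
  rw [Finset.mem_filter, and_iff_right_iff_imp]
  intro H
  simpa using H ∅

theorem mem_cubeBase_insertNth (A : Finset G) {d : ℕ} (i : Fin (d + 1)) (t : G) (h : Fin d → G)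
    (x : G) : x ∈ cubeBase A (i.insertNth (α := fun _ => G) t h) ↔
      x ∈ cubeBase A h ∧ x + t ∈ cubeBase A h := by
  simp only [mem_cubeBase]
  constructor
  · intro H
    refine ⟨fun S => ?_, fun S => ?_⟩
    · simpa [Finset.sum_map] using H (S.map i.succAboveEmb)
    · have := H (insert i (S.map i.succAboveEmb))
      rw [Finset.sum_insert (by simp [Fin.succAbove_ne])] at this
      simpa [Finset.sum_map, add_assoc] using this
  · rintro ⟨H1, H2⟩ S
    have e : ∑ j ∈ S, i.insertNth (α := fun _ => G) t h j =
        (if i ∈ S then t else 0) + ∑ j ∈ Finset.univ.filter (fun j => i.succAbove j ∈ S), h j := by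
      rw [← Finset.univ_inter S, ← Finset.sum_ite_mem, Fin.sum_univ_succAbove _ i,
        Finset.sum_filter]
      simp
    rw [e]
    split_ifs
    · rw [← add_assoc]; exact H2 _
    · rw [zero_add]; exact H1 _

theorem gowersU_eq_sum (A : Finset G) (d : ℕ) :
    gowersU A d = ∑ h : Fin d → (A - A : Finset G), (cubeBase A fun i => (h i : G)).card := by
  unfold gowersU
  rw [← Finset.card_sigma]
  symm
  refine Finset.card_bij (fun p _ => (p.2, fun i => (p.1 i : G))) ?_ ?_ ?_
  · rintro ⟨h, x⟩ hp
    simp only [Finset.mem_sigma, Finset.mem_univ, true_and] at hp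
    simp only [Finset.mem_filter, Finset.mem_product, Fintype.mem_piFinset]
    exact ⟨⟨(Finset.mem_filter.1 hp).1, fun i => (h i).2⟩, (Finset.mem_filter.1 hp).2⟩
  · rintro ⟨h, x⟩ _ ⟨h', x'⟩ _ heq
    simp only [Prod.mk.injEq] at heq
    obtain ⟨rfl, h2⟩ := heq
    have : h = h' := funext fun i => Subtype.ext (congrFun h2 i)
    subst this
    rfl
  · rintro ⟨x, h⟩ hp
    simp only [Finset.mem_filter, Finset.mem_product, Fintype.mem_piFinset] at hp
    refine ⟨⟨fun i => ⟨h i, hp.1.2 i⟩, x⟩, ?_, rfl⟩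
    simp only [Finset.mem_sigma, Finset.mem_univ, true_and]
    exact (mem_cubeBase _ _ _).2 hp.2

theorem sum_cubeBase (A : Finset G) {d : ℕ} (i : Fin (d + 1))
    (h : Fin d → (A - A : Finset G)) :
    ∑ t : (A - A : Finset G),
      (cubeBase A fun j => (i.insertNth (α := fun _ => (A - A : Finset G)) t h j : G)).card =
      (cubeBase A fun j => (h j : G)).card ^ 2 := by
  have e : ∀ t : (A - A : Finset G),
      (fun j => (i.insertNth (α := fun _ => (A - A : Finset G)) t h j : G)) =
      i.insertNth (α := fun _ => G) (t : G) (fun j => (h j : G)) := by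
    intro t
    ext j
    refine Fin.succAboveCases i ?_ (fun j => ?_) j <;> simp
  simp only [e]
  rw [← Finset.card_sigma, sq, ← Finset.card_product]
  refine Finset.card_bij (fun p _ => (p.2, p.2 + (p.1 : G))) ?_ ?_ ?_
  · rintro ⟨t, x⟩ hp
    simp only [Finset.mem_sigma, Finset.mem_univ, true_and, mem_cubeBase_insertNth] at hp
    exact Finset.mem_product.2 hp
  · rintro ⟨t, x⟩ _ ⟨t', x'⟩ _ heq
    simp only [Prod.mk.injEq] at heq
    obtain ⟨rfl, h2⟩ := heq
    have : t = t' := Subtype.ext (add_left_cancel h2)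
    subst this
    rfl
  · rintro ⟨x, y⟩ hp
    rw [Finset.mem_product] at hp
    refine ⟨⟨⟨y - x, Finset.sub_mem_sub (Finset.mem_filter.1 hp.2).1
      (Finset.mem_filter.1 hp.1).1⟩, x⟩, ?_, ?_⟩
    · simp only [Finset.mem_sigma, Finset.mem_univ, true_and, mem_cubeBase_insertNth]
      simpa using hp
    · simp

theorem gowersU_succ (A : Finset G) (d : ℕ) :
    gowersU A (d + 1) =
      ∑ h : Fin d → (A - A : Finset G), (cubeBase A fun i => (h i : G)).card ^ 2 := by
  rw [gowersU_eq_sum, sum_insertNth_aux d 0]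
  exact Finset.sum_congr rfl fun h _ => sum_cubeBase A 0 h

theorem gowersU_pos (A : Finset G) (hA : A.Nonempty) (d : ℕ) : 0 < gowersU A d := by
  obtain ⟨x, hx⟩ := hA
  refine Finset.card_pos.2 ⟨(x, fun _ => 0), ?_⟩
  simp only [Finset.mem_filter, Finset.mem_product, Fintype.mem_piFinset]
  refine ⟨⟨hx, fun _ => ?_⟩, fun S => by simpa using hx⟩
  simpa using Finset.sub_mem_sub hx hx

theorem gowers_main (A : Finset G) (hA : A.Nonempty) (n : ℕ) :
    gowersU A (n + 2) ^ (3 * n + 4) ≤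
      gowersU A (n + 3) ^ (n + 1) * gowersU A (n + 1) ^ (2 * (n + 2)) := by
  have p1 : (0 : ℝ) < gowersU A (n + 1) := by exact_mod_cast gowersU_pos A hA _
  have p2 : (0 : ℝ) < gowersU A (n + 2) := by exact_mod_cast gowersU_pos A hA _
  have p3 : (0 : ℝ) < gowersU A (n + 3) := by exact_mod_cast gowersU_pos A hA _
  have key := core_aux n
    (fun h : Fin (n + 2) → (A - A : Finset G) => ((cubeBase A fun i => (h i : G)).card : ℝ))
    (fun h : Fin (n + 1) → (A - A : Finset G) => ((cubeBase A fun i => (h i : G)).card : ℝ))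
    (fun _ => Nat.cast_nonneg _) (fun _ => Nat.cast_nonneg _)
    (fun i h' => by exact_mod_cast sum_cubeBase A i h')
    (gowersU A (n + 2)) (gowersU A (n + 1)) (gowersU A (n + 3)) p2 p1 p3
    (by rw [gowersU_eq_sum]; push_cast; rfl) (by rw [gowersU_eq_sum]; push_cast; rfl)
    (by rw [gowersU_succ]; push_cast; rfl)
  have : ((gowersU A (n + 2) : ℝ)) ^ (3 * n + 4) ≤
      (gowersU A (n + 3) : ℝ) ^ (n + 1) * (gowersU A (n + 1) : ℝ) ^ (2 * (n + 2)) := by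
    rw [← Real.log_le_log_iff (by positivity) (by positivity),
      Real.log_mul (by positivity) (by positivity), Real.log_pow, Real.log_pow, Real.log_pow]
    push_cast
    exact key
  exact_mod_cast this

theorem gowersU_one (A : Finset G) : gowersU A 1 = A.card ^ 2 := by
  rw [gowersU_succ, Fintype.sum_unique]
  congr 2
  ext x
  rw [mem_cubeBase]
  constructor
  · intro H; simpa using H ∅
  · intro H S; rw [Finset.eq_empty_of_isEmpty S]; simpa using H

theorem stmt_14 (A : Finset G) (hA : A.Nonempty) (k : ℕ) (hk : 2 ≤ k) :
    gowersU A k ^ (3 * k - 2) ≤ gowersU A (k + 1) ^ (k - 1) * gowersU A (k - 1) ^ (2 * k) ∧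
    energy A ^ 4 ≤ gowersU A 3 * A.card ^ 8 := by
  constructor
  · obtain ⟨n, rfl⟩ := Nat.exists_eq_add_of_le' hk
    exact gowers_main A hA n
  · have := gowers_main A hA 0
    simp only [zero_add, mul_zero, pow_one, gowersU_one, ← pow_mul] at this
    exact this
end
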